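/- A finite-dimensional Poisson algebra P is φ-free (i.e., φ(P) = 0) if and only if P splits over its zero socle: P = Zsoc(P) ⊕ C (vector space direct sum) for some subalgebra C, where Zsoc(P) is the sum of all minimal zero ideals of P. -/

import Mathlib

/-!  Framework: dialgebras and Poisson algebras as bilinear structures on a module. -/

variable {F P : Type*} [Field F] [AddCommGroup P] [Module F P]

/-- A dialgebra: a vector space with two bilinear multiplications. -/
structure Dialgebra (F P : Type*) [Field F] [AddCommGroup P] [Module F P] where
  mul : P →ₗ[F] P →ₗ[F] P
  bracket : P →ₗ[F] P →ₗ[F] P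

namespace Dialgebra

variable (D : Dialgebra F P)

/-- Span of the set of products `a·b`, `a ∈ A`, `b ∈ B`. -/
def pmul (A B : Submodule F P) : Submodule F P :=
  Submodule.span F (Set.image2 (fun a b => D.mul a b) (A : Set P) (B : Set P))

/-- Span of the set of brackets `[a,b]`, `a ∈ A`, `b ∈ B`. -/
def pbra (A B : Submodule F P) : Submodule F P :=
  Submodule.span F (Set.image2 (fun a b => D.bracket a b) (A : Set P) (B : Set P))

/-- `A·B + [A,B]`. -/
def psq (A B : Submodule F P) : Submodule F P := D.pmul A B ⊔ D.pbra A B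

/-- A subalgebra: a subspace closed under both products. -/
def IsSubalgebra (A : Submodule F P) : Prop := D.psq A A ≤ A

/-- An ideal of the dialgebra. -/
def IsIdeal (A : Submodule F P) : Prop :=
  D.pmul A ⊤ ≤ A ∧ D.pmul ⊤ A ≤ A ∧ D.pbra A ⊤ ≤ A ∧ D.pbra ⊤ A ≤ A

/-- `A` is an ideal of the subalgebra `U`. -/
def IsIdealIn (A U : Submodule F P) : Prop :=
  A ≤ U ∧ D.pmul A U ≤ A ∧ D.pmul U A ≤ A ∧ D.pbra A U ≤ A ∧ D.pbra U A ≤ A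

/-- Lower central series of `B`: `B^1 = B`, `B^{n+1} = B^n·B + [B^n,B]`. -/
def lcs (B : Submodule F P) : ℕ → Submodule F P
  | 0 => B
  | n + 1 => D.psq (lcs B n) B

/-- `B` is nilpotent as a dialgebra. -/
def IsNilpotentSub (B : Submodule F P) : Prop := ∃ n, D.lcs B n = ⊥

/-- Derived series of `B`. -/
def ders (B : Submodule F P) : ℕ → Submodule F P
  | 0 => B
  | n + 1 => D.psq (ders B n) (ders B n)

/-- `B` is solvable as a dialgebra. -/
def IsSolvableSub (B : Submodule F P) : Prop := ∃ n, D.ders B n = ⊥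

/-- Associative powers: `apow B n = B_A^{n+1}`, i.e. `apow B 0 = B_A^1 = B`. -/
def apow (B : Submodule F P) : ℕ → Submodule F P
  | 0 => B
  | n + 1 => D.pmul (apow B n) B

/-- Lie powers: `lpow B n = B_L^{n+1}`. -/
def lpow (B : Submodule F P) : ℕ → Submodule F P
  | 0 => B
  | n + 1 => D.pbra (lpow B n) B

/-- Associative nilpotency of `B`. -/
def AssocNilpotent (B : Submodule F P) : Prop := ∃ n, D.apow B n = ⊥

/-- Lie nilpotency of `B`. -/
def LieNilpotent (B : Submodule F P) : Prop := ∃ n, D.lpow B n = ⊥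

/-- `mulPows B X n = X·B_A^n` (with the convention that it is `X` for `n = 0`). -/
def mulPows (B X : Submodule F P) : ℕ → Submodule F P
  | 0 => X
  | n + 1 => D.pmul (mulPows B X n) B

/-- `M` is a maximal (proper) subalgebra of the subalgebra `U`. -/
def IsMaximalSubalgebraIn (U M : Submodule F P) : Prop :=
  D.IsSubalgebra M ∧ M < U ∧ ∀ K, D.IsSubalgebra K → M ≤ K → K ≤ U → K = M ∨ K = U

/-- Frattini subalgebra of the subalgebra `U`: intersection of its maximal subalgebras. -/
def frattiniIn (U : Submodule F P) : Submodule F P :=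
  U ⊓ sInf {M | D.IsMaximalSubalgebraIn U M}

/-- Frattini ideal of the subalgebra `U`: largest ideal of `U` inside `frattiniIn U`. -/
def phiIn (U : Submodule F P) : Submodule F P :=
  sSup {I | D.IsIdealIn I U ∧ I ≤ D.frattiniIn U}

/-- Frattini subalgebra of the dialgebra. -/
def frattini : Submodule F P := D.frattiniIn ⊤

/-- Frattini ideal of the dialgebra. -/
def phi : Submodule F P := sSup {I | D.IsIdeal I ∧ I ≤ D.frattini}

/-- Minimal ideal. -/
def IsMinimalIdeal (A : Submodule F P) : Prop :=
  D.IsIdeal A ∧ A ≠ ⊥ ∧ ∀ I, D.IsIdeal I → I ≤ A → I = ⊥ ∨ I = A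

/-- Zero (trivial-multiplication) subspace. -/
def IsZeroAlg (A : Submodule F P) : Prop := D.pmul A A = ⊥ ∧ D.pbra A A = ⊥

/-- Zero socle: sum of the minimal zero ideals. -/
def zsoc : Submodule F P := sSup {A | D.IsMinimalIdeal A ∧ D.IsZeroAlg A}

/-- Socle: sum of the minimal ideals. -/
def soc : Submodule F P := sSup {A | D.IsMinimalIdeal A}

/-- Annihilator of `B` in the algebra. -/
def annih (B : Submodule F P) : Submodule F P where
  carrier := {x | ∀ b ∈ B, D.mul x b = 0 ∧ D.bracket x b = 0}
  add_mem' := by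
    intro x y hx hy b hb
    have h1 := hx b hb; have h2 := hy b hb
    constructor <;> simp [map_add, LinearMap.add_apply, h1.1, h1.2, h2.1, h2.2]
  zero_mem' := by intro b hb; simp
  smul_mem' := by
    intro c x hx b hb
    have h := hx b hb
    constructor <;> simp [map_smul, LinearMap.smul_apply, h.1, h.2]

/-- `R` is the solvable radical: the largest solvable ideal. -/
def IsRadical (R : Submodule F P) : Prop :=
  D.IsIdeal R ∧ D.IsSolvableSub R ∧ ∀ I, D.IsIdeal I → D.IsSolvableSub I → I ≤ R

/-- `N` is the nilradical: the largest nilpotent ideal. -/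
def IsNilradical (N : Submodule F P) : Prop :=
  D.IsIdeal N ∧ D.IsNilpotentSub N ∧ ∀ I, D.IsIdeal I → D.IsNilpotentSub I → I ≤ N

end Dialgebra

/-- A Poisson algebra: commutative associative product and Lie bracket linked by the Leibniz rule. -/
structure PoissonAlgebra (F P : Type*) [Field F] [AddCommGroup P] [Module F P]
    extends Dialgebra F P where
  mul_comm : ∀ x y, mul x y = mul y x
  mul_assoc : ∀ x y z, mul (mul x y) z = mul x (mul y z)
  lie_self : ∀ x, bracket x x = 0
  leibniz_lie : ∀ x y z, bracket x (bracket y z) = bracket (bracket x y) z + bracket y (bracket x z)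
  leibniz : ∀ x y z, bracket (mul x y) z = mul (bracket x z) y + mul x (bracket y z)

/-- In a finite-dimensional commutative associative algebra, a nonzero ideal equal to its square
contains a nonzero idempotent. -/
theorem exists_idempotent_mem_of_mul_self_eq {F R : Type*} [Field F] [NonUnitalCommRing R]
    [Module F R] [IsScalarTower F R R] [SMulCommClass F R R] [FiniteDimensional F R]
    (A : Submodule F R) (hA : ∀ x, ∀ a ∈ A, x * a ∈ A) (hne : A ≠ ⊥)
    (hsq : A ≤ Submodule.span F (Set.image2 (fun a b => a * b) (A : Set R) (A : Set R))) :
    ∃ e ∈ A, e ≠ 0 ∧ e * e = e := by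
  let I : Ideal (Unitization F R) :=
    { carrier := {z | z.fst = 0 ∧ z.snd ∈ A}
      add_mem' := fun {x y} hx hy => ⟨by simp [hx.1, hy.1], by simpa using A.add_mem hx.2 hy.2⟩
      zero_mem' := by simp
      smul_mem' := fun c x hx => ⟨by simp [hx.1], by
        simpa [hx.1] using A.add_mem (A.smul_mem c.fst hx.2) (hA c.snd _ hx.2)⟩ }
  have inr_mem : ∀ a ∈ A, (a : Unitization F R) ∈ I := fun a ha => ⟨by simp, by simpa using ha⟩
  have eq_inr : ∀ z ∈ I, z = (z.snd : Unitization F R) := fun z hz =>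
    Unitization.ext (by simpa using hz.1) (by simp)
  have hfg : I.FG := by
    apply Submodule.FG.of_restrictScalars F
    have : I.restrictScalars F = A.map (Unitization.inrHom F F R) := by
      ext z
      simp only [Submodule.restrictScalars_mem, Submodule.mem_map, Unitization.inrHom_apply]
      constructor
      · exact fun hz => ⟨z.snd, hz.2, (eq_inr z hz).symm⟩
      · rintro ⟨a, ha, rfl⟩
        exact inr_mem a ha
    rw [this]
    exact (IsNoetherian.noetherian A).map _
  have hidem : IsIdempotentElem I := by
    refine le_antisymm Ideal.mul_le_right fun z hz => ?_
    rw [eq_inr z hz]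
    have key : Submodule.span F (Set.image2 (fun a b => a * b) (A : Set R) (A : Set R)) ≤
        ((I * I).restrictScalars F).comap (Unitization.inrHom F F R) := by
      rw [Submodule.span_le]
      rintro _ ⟨a, ha, b, hb, rfl⟩
      rw [SetLike.mem_coe, Submodule.mem_comap, Submodule.restrictScalars_mem,
        Unitization.inrHom_apply, Unitization.inr_mul]
      exact Ideal.mul_mem_mul (inr_mem a ha) (inr_mem b hb)
    exact key (hsq hz.2)
  obtain ⟨e, he, hI⟩ := (Ideal.isIdempotentElem_iff_of_fg I hfg).mp hidem
  have heI : e ∈ I := by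
    rw [hI]
    exact Submodule.mem_span_singleton_self e
  refine ⟨e.snd, heI.2, fun h0 => hne ?_, ?_⟩
  · have he0 : e = 0 := by rw [eq_inr e heI, h0, Unitization.inr_zero]
    rw [Submodule.eq_bot_iff]
    intro a ha
    have := inr_mem a ha
    rw [hI, he0, Submodule.span_zero_singleton, Submodule.mem_bot] at this
    simpa using congrArg (fun z => z.snd) this
  · have := congrArg (fun z => z.snd) he.eq
    simpa [heI.1] using this

/-- A perfect ideal consisting of ad-nilpotent elements of a finite-dimensional Lie algebra is
zero. -/
theorem LieIdeal.eq_bot_of_lie_self_eq_of_isNilpotent_ad {F L : Type*} [Field F] [LieRing L]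
    [LieAlgebra F L] [FiniteDimensional F L] (I : LieIdeal F L) (hperf : ⁅I, I⁆ = I)
    (hnil : ∀ a ∈ I, IsNilpotent (LieAlgebra.ad F L a)) : I = ⊥ := by
  have : IsNoetherian F (LieIdeal.toLieSubalgebra F L I) :=
    isNoetherian_of_injective (LieIdeal.toLieSubalgebra F L I).toSubmodule.subtype
      Subtype.val_injective
  have hI : LieRing.IsNilpotent I := (LieAlgebra.isNilpotent_iff_forall (R := F)
    (L := LieIdeal.toLieSubalgebra F L I)).mpr fun a =>
    LieSubalgebra.isNilpotent_ad_of_isNilpotent_ad (I : LieSubalgebra F L) (x := a)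
      (hnil a a.2)
  have hsolv : LieAlgebra.IsSolvable I := inferInstance
  obtain ⟨k, hk⟩ := LieAlgebra.IsSolvable.solvable F I
  rw [LieIdeal.derivedSeries_eq_bot_iff] at hk
  rw [← hk]
  exact (Function.iterate_fixed (f := fun J : LieIdeal F L => ⁅J, J⁆) hperf k).symm

/-- If `d` is a derivation of a bilinear operation `β`, then `β x y` lies in the generalized
null space of `d` whenever `x` and `y` do. -/
theorem LinearMap.pow_add_apply_eq_zero_of_derivation {R M : Type*} [CommRing R] [AddCommGroup M]
    [Module R M] (β : M →ₗ[R] M →ₗ[R] M) (d : Module.End R M)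
    (hd : ∀ x y, d (β x y) = β (d x) y + β x (d y)) (n m : ℕ) (x y : M)
    (hx : (d ^ n) x = 0) (hy : (d ^ m) y = 0) : (d ^ (n + m)) (β x y) = 0 := by
  induction n generalizing x y m with
  | zero =>
    have : x = 0 := by simpa using hx
    simp [this]
  | succ n ihn =>
    induction m generalizing x y with
    | zero =>
      have : y = 0 := by simpa using hy
      simp [this]
    | succ m ihm =>
      have h₁ := ihn (m + 1) (d x) y (by simpa [pow_succ] using hx) hy
      have h₂ := ihm x (d y) hx (by simpa [pow_succ] using hy)
      have e : n + 1 + (m + 1) = (n + (m + 1)) + 1 := by omega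
      have e' : n + 1 + m = n + (m + 1) := by omega
      rw [e'] at h₂
      rw [e, pow_succ, Module.End.mul_apply, hd, map_add, h₁, h₂, add_zero]

namespace Dialgebra

theorem mul_mem_pmul (D : Dialgebra F P) {A B : Submodule F P} {a b : P} (ha : a ∈ A)
    (hb : b ∈ B) : D.mul a b ∈ D.pmul A B :=
  Submodule.subset_span ⟨a, ha, b, hb, rfl⟩

theorem bracket_mem_pbra (D : Dialgebra F P) {A B : Submodule F P} {a b : P} (ha : a ∈ A)
    (hb : b ∈ B) : D.bracket a b ∈ D.pbra A B :=
  Submodule.subset_span ⟨a, ha, b, hb, rfl⟩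

theorem pmul_le {D : Dialgebra F P} {A B C : Submodule F P} :
    D.pmul A B ≤ C ↔ ∀ a ∈ A, ∀ b ∈ B, D.mul a b ∈ C := by
  rw [pmul, Submodule.span_le, Set.image2_subset_iff]
  rfl

theorem pbra_le {D : Dialgebra F P} {A B C : Submodule F P} :
    D.pbra A B ≤ C ↔ ∀ a ∈ A, ∀ b ∈ B, D.bracket a b ∈ C := by
  rw [pbra, Submodule.span_le, Set.image2_subset_iff]
  rfl

theorem isSubalgebra_iff {D : Dialgebra F P} {A : Submodule F P} :
    D.IsSubalgebra A ↔ ∀ a ∈ A, ∀ b ∈ A, D.mul a b ∈ A ∧ D.bracket a b ∈ A := by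
  rw [IsSubalgebra, psq, sup_le_iff, pmul_le, pbra_le]
  grind

theorem isIdeal_iff {D : Dialgebra F P} {A : Submodule F P} :
    D.IsIdeal A ↔ ∀ a ∈ A, ∀ x, D.mul a x ∈ A ∧ D.mul x a ∈ A ∧
      D.bracket a x ∈ A ∧ D.bracket x a ∈ A := by
  simp only [IsIdeal, pmul_le, pbra_le, Submodule.mem_top, true_imp_iff]
  grind

theorem isZeroAlg_iff {D : Dialgebra F P} {A : Submodule F P} :
    D.IsZeroAlg A ↔ ∀ a ∈ A, ∀ b ∈ A, D.mul a b = 0 ∧ D.bracket a b = 0 := by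
  rw [IsZeroAlg, ← le_bot_iff, ← le_bot_iff, pmul_le, pbra_le]
  simp only [Submodule.mem_bot]
  grind

variable {D : Dialgebra F P}

theorem isSubalgebra_top : D.IsSubalgebra ⊤ := le_top

theorem isIdeal_bot : D.IsIdeal ⊥ := by
  rw [isIdeal_iff]
  simp

theorem IsIdeal.inf {A B : Submodule F P} (hA : D.IsIdeal A) (hB : D.IsIdeal B) :
    D.IsIdeal (A ⊓ B) := by
  rw [isIdeal_iff] at *
  intro a ha x
  obtain ⟨h₁, h₂, h₃, h₄⟩ := hA a ha.1 x
  obtain ⟨k₁, k₂, k₃, k₄⟩ := hB a ha.2 x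
  exact ⟨⟨h₁, k₁⟩, ⟨h₂, k₂⟩, ⟨h₃, k₃⟩, ⟨h₄, k₄⟩⟩

theorem IsIdeal.sSup {S : Set (Submodule F P)} (hS : ∀ A ∈ S, D.IsIdeal A) :
    D.IsIdeal (sSup S) := by
  rw [isIdeal_iff]
  intro a ha x
  have key : SupSet.sSup S ≤
      (SupSet.sSup S).comap (D.mul.flip x) ⊓ (SupSet.sSup S).comap (D.mul x) ⊓
        ((SupSet.sSup S).comap (D.bracket.flip x) ⊓ (SupSet.sSup S).comap (D.bracket x)) := by
    refine sSup_le fun A hA b hb => ?_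
    obtain ⟨h₁, h₂, h₃, h₄⟩ := isIdeal_iff.mp (hS A hA) b hb x
    have hle : A ≤ SupSet.sSup S := le_sSup hA
    exact ⟨⟨hle h₁, hle h₂⟩, ⟨hle h₃, hle h₄⟩⟩
  obtain ⟨⟨h₁, h₂⟩, ⟨h₃, h₄⟩⟩ := key ha
  exact ⟨h₁, h₂, h₃, h₄⟩

theorem IsIdeal.sup {A B : Submodule F P} (hA : D.IsIdeal A) (hB : D.IsIdeal B) :
    D.IsIdeal (A ⊔ B) := by
  rw [← sSup_pair]
  apply IsIdeal.sSup
  rintro C (rfl | rfl)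
  exacts [hA, hB]

theorem IsIdeal.sup_isSubalgebra {A B : Submodule F P} (hA : D.IsIdeal A)
    (hB : D.IsSubalgebra B) : D.IsSubalgebra (A ⊔ B) := by
  rw [isIdeal_iff] at hA
  rw [isSubalgebra_iff] at *
  intro x hx y hy
  obtain ⟨a, ha, b, hb, rfl⟩ := Submodule.mem_sup.mp hx
  obtain ⟨a', ha', b', hb', rfl⟩ := Submodule.mem_sup.mp hy
  have hl : A ≤ A ⊔ B := le_sup_left
  have hr : B ≤ A ⊔ B := le_sup_right
  obtain ⟨h₁, -, h₂, -⟩ := hA a ha (a' + b')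
  obtain ⟨-, h₃, -, h₄⟩ := hA a' ha' b
  obtain ⟨h₅, h₆⟩ := hB b hb b' hb'
  constructor
  · rw [map_add D.mul, LinearMap.add_apply, map_add (D.mul b)]
    exact add_mem (hl h₁) (add_mem (hl h₃) (hr h₅))
  · rw [map_add D.bracket, LinearMap.add_apply, map_add (D.bracket b)]
    exact add_mem (hl h₂) (add_mem (hl h₄) (hr h₆))

theorem IsSubalgebra.inf {A B : Submodule F P} (hA : D.IsSubalgebra A) (hB : D.IsSubalgebra B) :
    D.IsSubalgebra (A ⊓ B) := by
  rw [isSubalgebra_iff] at *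
  intro a ha b hb
  exact ⟨⟨(hA a ha.1 b hb.1).1, (hB a ha.2 b hb.2).1⟩,
    ⟨(hA a ha.1 b hb.1).2, (hB a ha.2 b hb.2).2⟩⟩

theorem isIdeal_zsoc : D.IsIdeal D.zsoc :=
  IsIdeal.sSup fun _ hA => hA.1.1

theorem isZeroAlg_zsoc : D.IsZeroAlg D.zsoc := by
  have hAB : ∀ A, D.IsMinimalIdeal A ∧ D.IsZeroAlg A → ∀ B, D.IsMinimalIdeal B ∧ D.IsZeroAlg B →
      ∀ a ∈ A, ∀ b ∈ B, D.mul a b = 0 ∧ D.bracket a b = 0 := by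
    rintro A ⟨hA, hA0⟩ B ⟨hB, -⟩ a ha b hb
    by_cases h : A = B
    · subst h
      exact isZeroAlg_iff.mp hA0 a ha b hb
    have hinf : A ⊓ B = ⊥ := by
      refine (hA.2.2 _ (hA.1.inf hB.1) inf_le_left).resolve_right fun hle => ?_
      exact (hB.2.2 A hA.1 (inf_eq_left.mp hle)).elim hA.2.1 h
    have h₁ := isIdeal_iff.mp hA.1 a ha b
    have h₂ := isIdeal_iff.mp hB.1 b hb a
    rw [← Submodule.mem_bot F, ← Submodule.mem_bot F (x := D.bracket a b), ← hinf]
    exact ⟨⟨h₁.1, h₂.2.1⟩, ⟨h₁.2.2.1, h₂.2.2.2⟩⟩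
  have hle : D.zsoc ≤ D.annih D.zsoc := by
    refine sSup_le fun A hA a ha => ?_
    have : D.zsoc ≤ LinearMap.ker (D.mul a) ⊓ LinearMap.ker (D.bracket a) :=
      sSup_le fun B hB b hb => hAB A hA B hB a ha b hb
    exact fun b hb => this hb
  exact isZeroAlg_iff.mpr fun a ha => hle ha

theorem le_phi {I : Submodule F P} (hI : D.IsIdeal I) (hle : I ≤ D.frattini) : I ≤ D.phi :=
  le_sSup ⟨hI, hle⟩

/-- Every nonzero ideal of a finite-dimensional dialgebra contains a minimal ideal. -/
theorem IsIdeal.exists_isMinimalIdeal_le [FiniteDimensional F P] {I : Submodule F P}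
    (hI : D.IsIdeal I) (hne : I ≠ ⊥) : ∃ A, D.IsMinimalIdeal A ∧ A ≤ I := by
  obtain ⟨A, ⟨hA, hA0, hAI⟩, hmin⟩ :=
    wellFounded_lt.has_min {A : Submodule F P | D.IsIdeal A ∧ A ≠ ⊥ ∧ A ≤ I} ⟨I, hI, hne, le_rfl⟩
  refine ⟨A, ⟨hA, hA0, fun J hJ hJA => ?_⟩, hAI⟩
  by_contra! h
  exact hmin J ⟨hJ, h.1, hJA.trans hAI⟩ (lt_of_le_of_ne hJA h.2)

/-- A subspace of the Frattini subalgebra can be omitted when it supplements a subalgebra. -/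
theorem eq_top_of_sup_eq_top_of_le_frattini [FiniteDimensional F P] {I B : Submodule F P}
    (hI : I ≤ D.frattini) (hB : D.IsSubalgebra B) (hsup : I ⊔ B = ⊤) : B = ⊤ := by
  by_contra hne
  obtain ⟨M, ⟨hM, hBM, hMtop⟩, hmax⟩ := wellFounded_gt.has_min
    {K : Submodule F P | D.IsSubalgebra K ∧ B ≤ K ∧ K ≠ ⊤} ⟨B, hB, le_rfl, hne⟩
  have hmaxM : D.IsMaximalSubalgebraIn ⊤ M := by
    refine ⟨hM, lt_top_iff_ne_top.mpr hMtop, fun K hK hMK _ => ?_⟩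
    by_contra! h
    exact hmax K ⟨hK, hBM.trans hMK, h.2⟩ (lt_of_le_of_ne hMK (Ne.symm h.1))
  have hIM : I ≤ M := hI.trans (inf_le_right.trans (sInf_le hmaxM))
  exact hMtop (top_le_iff.mp (hsup ▸ sup_le hIM hBM))

/-- A zero ideal meeting the Frattini ideal trivially is complemented by a subalgebra. -/
theorem IsIdeal.exists_isSubalgebra_isCompl [FiniteDimensional F P] {B : Submodule F P}
    (hB : D.IsIdeal B) (hB0 : D.IsZeroAlg B) (hphi : B ⊓ D.phi = ⊥) :
    ∃ C, D.IsSubalgebra C ∧ B ⊓ C = ⊥ ∧ B ⊔ C = ⊤ := by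
  obtain ⟨C, ⟨hC, hBC⟩, hmin⟩ := wellFounded_lt.has_min
    {C : Submodule F P | D.IsSubalgebra C ∧ B ⊔ C = ⊤} ⟨⊤, isSubalgebra_top, sup_top_eq B⟩
  refine ⟨C, hC, ?_, hBC⟩
  have hideal : D.IsIdeal (B ⊓ C) := by
    rw [isIdeal_iff]
    rintro a ⟨haB, haC⟩ x
    obtain ⟨b, hb, c, hc, rfl⟩ := Submodule.mem_sup.mp (hBC ▸ Submodule.mem_top : x ∈ B ⊔ C)
    have h₁ := isZeroAlg_iff.mp hB0 a haB b hb
    have h₂ := isZeroAlg_iff.mp hB0 b hb a haB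
    have h₃ := isIdeal_iff.mp hB a haB c
    have h₄ := isSubalgebra_iff.mp hC a haC c hc
    have h₅ := isSubalgebra_iff.mp hC c hc a haC
    simp only [map_add, LinearMap.add_apply, h₁.1, h₁.2, h₂.1, h₂.2, zero_add]
    exact ⟨⟨h₃.1, h₄.1⟩, ⟨h₃.2.1, h₅.1⟩, ⟨h₃.2.2.1, h₄.2⟩, ⟨h₃.2.2.2, h₅.2⟩⟩
  have hfrat : B ⊓ C ≤ D.frattini := by
    refine le_inf le_top (le_sInf fun M hM => ?_)
    by_contra hnot
    have hsup : B ⊓ C ⊔ M = ⊤ :=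
      (hM.2.2 _ (hideal.sup_isSubalgebra hM.1) le_sup_right le_top).resolve_left
        fun h => hnot (h ▸ le_sup_left)
    have hsplit : B ⊓ C ⊔ M ⊓ C = C := by
      rw [← sup_inf_assoc_of_le M inf_le_right, hsup, top_inf_eq]
    have htop : B ⊔ M ⊓ C = ⊤ := by
      rw [← hBC]
      conv_rhs => rw [← hsplit]
      rw [← sup_assoc, sup_eq_left.mpr (inf_le_left : B ⊓ C ≤ B)]
    have hMC : M ⊓ C = C := by
      by_contra hne
      exact hmin _ ⟨hM.1.inf hC, htop⟩ (lt_of_le_of_ne inf_le_right hne)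
    exact hnot (inf_le_right.trans (inf_eq_right.mp hMC))
  rw [← le_bot_iff, ← hphi]
  exact le_inf inf_le_left (le_phi hideal hfrat)

/-- A minimal zero ideal is a direct summand of the zero socle among ideals. -/
theorem exists_isIdeal_isCompl_zsoc [FiniteDimensional F P] {A : Submodule F P}
    (hAz : A ≤ D.zsoc) (hA : D.IsIdeal A) :
    ∃ A', D.IsIdeal A' ∧ A' ≤ D.zsoc ∧ A ⊓ A' = ⊥ ∧ A ⊔ A' = D.zsoc := by
  obtain ⟨A', ⟨hA', hA'z, hdis⟩, hmax⟩ := wellFounded_gt.has_min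
    {B : Submodule F P | D.IsIdeal B ∧ B ≤ D.zsoc ∧ Disjoint A B}
    ⟨⊥, isIdeal_bot, bot_le, disjoint_bot_right⟩
  refine ⟨A', hA', hA'z, hdis.eq_bot, le_antisymm (sup_le hAz hA'z) (sSup_le fun B hB => ?_)⟩
  rcases hB.1.2.2 _ ((hA.sup hA').inf hB.1.1) inf_le_right with h | h
  · have hle : A' ⊔ B = A' := by
      by_contra hne
      exact hmax (A' ⊔ B) ⟨hA'.sup hB.1.1, sup_le hA'z (le_sSup hB),
        hdis.disjoint_sup_right_of_disjoint_sup_left (disjoint_iff.mpr h)⟩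
        (lt_of_le_of_ne le_sup_left (Ne.symm hne))
    exact (sup_eq_left.mp hle).trans le_sup_right
  · exact inf_eq_right.mp h

/-- If the dialgebra splits over its zero socle, no minimal zero ideal lies in the Frattini
subalgebra. -/
theorem IsMinimalIdeal.not_le_frattini_of_splits [FiniteDimensional F P] {A C : Submodule F P}
    (hA : D.IsMinimalIdeal A) (hA0 : D.IsZeroAlg A) (hC : D.IsSubalgebra C)
    (hinf : D.zsoc ⊓ C = ⊥) (hsup : D.zsoc ⊔ C = ⊤) : ¬ A ≤ D.frattini := by
  intro hle
  obtain ⟨A', hA', hA'z, hdis, hAA'⟩ :=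
    exists_isIdeal_isCompl_zsoc (le_sSup ⟨hA, hA0⟩ : A ≤ D.zsoc) hA.1
  have htop : A' ⊔ C = ⊤ := eq_top_of_sup_eq_top_of_le_frattini hle (hA'.sup_isSubalgebra hC)
    (by rw [← sup_assoc, hAA', hsup])
  have hz : D.zsoc = A' := by
    have := sup_inf_assoc_of_le C hA'z
    rwa [htop, top_inf_eq, inf_comm C, hinf, sup_bot_eq] at this
  apply hA.2.1
  rw [← hdis, eq_comm, inf_eq_left, ← hz]
  exact le_sSup ⟨hA, hA0⟩

end Dialgebra

namespace PoissonAlgebra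

open Dialgebra

/-- The Lie ring underlying a Poisson algebra. -/
abbrev lieRing (Q : PoissonAlgebra F P) : LieRing P where
  bracket x y := Q.bracket x y
  add_lie x y z := by simp
  lie_add x y z := by simp
  lie_self := Q.lie_self
  leibniz_lie := Q.leibniz_lie

/-- The Lie algebra underlying a Poisson algebra. -/
abbrev lieAlgebra (Q : PoissonAlgebra F P) : @LieAlgebra F P _ Q.lieRing :=
  letI := Q.lieRing
  { (inferInstance : Module F P) with
    lie_smul := fun t x y => by simp [Bracket.bracket] }

/-- The commutative associative ring underlying a Poisson algebra. -/
abbrev nonUnitalCommRing (Q : PoissonAlgebra F P) : NonUnitalCommRing P where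
  mul x y := Q.mul x y
  left_distrib x y z := map_add (Q.mul x) y z
  right_distrib x y z := by
    change Q.mul (x + y) z = Q.mul x z + Q.mul y z
    simp
  zero_mul x := by
    change Q.mul 0 x = 0
    simp
  mul_zero x := map_zero (Q.mul x)
  mul_assoc := Q.mul_assoc
  mul_comm := Q.mul_comm

variable (Q : PoissonAlgebra F P)

theorem bracket_skew (x y : P) : Q.bracket x y = -Q.bracket y x := by
  have h := Q.lie_self (x + y)
  simp only [map_add, LinearMap.add_apply, Q.lie_self, zero_add, add_zero] at h
  exact eq_neg_of_add_eq_zero_right h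

theorem bracket_mul (a x y : P) :
    Q.bracket a (Q.mul x y) = Q.mul (Q.bracket a x) y + Q.mul x (Q.bracket a y) := by
  rw [Q.bracket_skew a, Q.leibniz, Q.bracket_skew a x, Q.bracket_skew a y]
  simp only [map_neg, LinearMap.neg_apply]
  abel

theorem isIdeal_of_left {A : Submodule F P}
    (h : ∀ a ∈ A, ∀ x, Q.mul x a ∈ A ∧ Q.bracket x a ∈ A) : Q.toDialgebra.IsIdeal A := by
  refine isIdeal_iff.mpr fun a ha x => ⟨?_, (h a ha x).1, ?_, (h a ha x).2⟩
  · rw [Q.mul_comm]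
    exact (h a ha x).1
  · rw [Q.bracket_skew]
    exact A.neg_mem (h a ha x).2

theorem isIdeal_pmul_self {A : Submodule F P} (hA : Q.toDialgebra.IsIdeal A) :
    Q.toDialgebra.IsIdeal (Q.pmul A A) := by
  rw [isIdeal_iff] at hA
  refine Q.isIdeal_of_left fun a ha x => ?_
  have : Q.pmul A A ≤ (Q.pmul A A).comap (Q.mul x) ⊓ (Q.pmul A A).comap (Q.bracket x) := by
    refine pmul_le.mpr fun b hb c hc => ⟨?_, ?_⟩
    · rw [SetLike.mem_coe, Submodule.mem_comap, ← Q.mul_assoc]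
      exact Q.mul_mem_pmul (hA b hb x).2.1 hc
    · rw [SetLike.mem_coe, Submodule.mem_comap, Q.bracket_mul]
      exact add_mem (Q.mul_mem_pmul (hA b hb x).2.2.2 hc) (Q.mul_mem_pmul hb (hA c hc x).2.2.2)
  exact this ha

theorem isIdeal_pbra_self {A : Submodule F P} (hA : Q.toDialgebra.IsIdeal A)
    (hmul : Q.pmul A A = ⊥) : Q.toDialgebra.IsIdeal (Q.pbra A A) := by
  rw [isIdeal_iff] at hA
  rw [← le_bot_iff, pmul_le] at hmul
  refine Q.isIdeal_of_left fun a ha x => ?_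
  have : Q.pbra A A ≤ (Q.pbra A A).comap (Q.mul x) ⊓ (Q.pbra A A).comap (Q.bracket x) := by
    refine pbra_le.mpr fun b hb c hc => ⟨?_, ?_⟩
    · rw [SetLike.mem_coe, Submodule.mem_comap]
      have h := Q.leibniz x b c
      rw [(Submodule.mem_bot F).mp (hmul _ (hA c hc x).2.2.2 b hb), zero_add] at h
      rw [← h]
      exact Q.bracket_mem_pbra (hA b hb x).2.1 hc
    · rw [SetLike.mem_coe, Submodule.mem_comap, Q.leibniz_lie]
      exact add_mem (Q.bracket_mem_pbra (hA b hb x).2.2.2 hc)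
        (Q.bracket_mem_pbra hb (hA c hc x).2.2.2)
  exact this ha

variable [FiniteDimensional F P] {Q} {A : Submodule F P}

/-- An ideal inside the Frattini subalgebra contains no nonzero idempotent. -/
theorem eq_zero_of_idempotent_mem (hA : Q.toDialgebra.IsIdeal A)
    (hfrat : A ≤ Q.toDialgebra.frattini) {e : P} (heA : e ∈ A) (he : Q.mul e e = e) : e = 0 := by
  have hee : ∀ z, Q.mul e (Q.bracket e z) = 0 := fun z => by
    have h := Q.leibniz e e z
    rw [he, Q.mul_comm _ e] at h
    have h' := congrArg (Q.mul e) h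
    rw [map_add, ← Q.mul_assoc, he] at h'
    exact left_eq_add.mp h'
  have hez : ∀ z, Q.bracket e z = 0 := fun z => by
    have h := Q.leibniz e e z
    rwa [he, Q.mul_comm _ e, hee, add_zero] at h
  have hsub : Q.toDialgebra.IsSubalgebra (LinearMap.ker (Q.mul e)) := by
    rw [isSubalgebra_iff]
    intro x hx y hy
    rw [LinearMap.mem_ker] at hx hy
    constructor
    · rw [LinearMap.mem_ker, ← Q.mul_assoc, hx, map_zero, LinearMap.zero_apply]
    · have h := Q.leibniz e x y
      simp only [hx, hez, map_zero, LinearMap.zero_apply, zero_add] at h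
      exact h.symm
  have htop : LinearMap.ker (Q.mul e) = ⊤ := by
    refine eq_top_of_sup_eq_top_of_le_frattini hfrat hsub (eq_top_iff.mpr fun x _ => ?_)
    refine Submodule.mem_sup.mpr ⟨Q.mul e x, (isIdeal_iff.mp hA e heA x).1, x - Q.mul e x, ?_, ?_⟩
    · rw [LinearMap.mem_ker, map_sub, ← Q.mul_assoc, he, sub_self]
    · abel
  have : e ∈ LinearMap.ker (Q.mul e) := htop ▸ Submodule.mem_top
  rwa [LinearMap.mem_ker, he] at this

/-- Elements of an ideal inside the Frattini subalgebra are ad-nilpotent. -/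
theorem isNilpotent_bracket (hA : Q.toDialgebra.IsIdeal A)
    (hfrat : A ≤ Q.toDialgebra.frattini) {a : P} (ha : a ∈ A) :
    IsNilpotent (Q.bracket a : Module.End F P) := by
  set d : Module.End F P := Q.bracket a with hd
  obtain ⟨n, hn, hpos⟩ := ((LinearMap.eventually_isCompl_ker_pow_range_pow d).and
    (Filter.eventually_ge_atTop 1)).exists
  have hker : ∀ β : P →ₗ[F] P →ₗ[F] P, (∀ x y, d (β x y) = β (d x) y + β x (d y)) →
      ∀ x ∈ LinearMap.ker (d ^ n), ∀ y ∈ LinearMap.ker (d ^ n), β x y ∈ LinearMap.ker (d ^ n) := by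
    intro β hβ x hx y hy
    have h := LinearMap.pow_add_apply_eq_zero_of_derivation β d hβ n n x y hx hy
    rw [pow_add, Module.End.mul_apply] at h
    exact (Submodule.disjoint_def.mp hn.disjoint) _ h ⟨_, rfl⟩
  have hsub : Q.toDialgebra.IsSubalgebra (LinearMap.ker (d ^ n)) :=
    isSubalgebra_iff.mpr fun x hx y hy =>
      ⟨hker Q.mul (Q.bracket_mul a) x hx y hy, hker Q.bracket (Q.leibniz_lie a) x hx y hy⟩
  have hrange : LinearMap.range (d ^ n) ≤ A := by
    rintro _ ⟨x, rfl⟩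
    obtain ⟨m, rfl⟩ := Nat.exists_eq_add_of_le' hpos
    rw [pow_succ', Module.End.mul_apply]
    exact (isIdeal_iff.mp hA a ha _).2.2.1
  have htop : LinearMap.ker (d ^ n) = ⊤ :=
    eq_top_of_sup_eq_top_of_le_frattini hfrat hsub
      (top_le_iff.mp (hn.sup_eq_top ▸ sup_le le_sup_right (hrange.trans le_sup_left)))
  exact ⟨n, LinearMap.ker_eq_top.mp htop⟩

/-- A minimal ideal inside the Frattini subalgebra has zero associative product. -/
theorem pmul_self_eq_bot (hA : Q.toDialgebra.IsMinimalIdeal A)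
    (hfrat : A ≤ Q.toDialgebra.frattini) : Q.pmul A A = ⊥ := by
  have hle : Q.pmul A A ≤ A := pmul_le.mpr fun a ha b _ => (isIdeal_iff.mp hA.1 a ha b).1
  refine (hA.2.2 _ (Q.isIdeal_pmul_self hA.1) hle).resolve_right fun heq => ?_
  let := Q.nonUnitalCommRing
  have : IsScalarTower F P P := ⟨fun r x y => by
    change Q.mul (r • x) y = r • Q.mul x y
    simp⟩
  have : SMulCommClass F P P := ⟨fun r x y => ((Q.mul x).map_smul r y).symm⟩
  obtain ⟨e, heA, hne, he⟩ := exists_idempotent_mem_of_mul_self_eq A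
    (fun x a ha => (isIdeal_iff.mp hA.1 a ha x).2.1) hA.2.1 heq.ge
  exact hne (eq_zero_of_idempotent_mem hA.1 hfrat heA he)

/-- A minimal ideal inside the Frattini subalgebra is a zero ideal. -/
theorem isZeroAlg_of_le_frattini (hA : Q.toDialgebra.IsMinimalIdeal A)
    (hfrat : A ≤ Q.toDialgebra.frattini) : Q.toDialgebra.IsZeroAlg A := by
  have hmul := pmul_self_eq_bot hA hfrat
  refine ⟨hmul, ?_⟩
  have hle : Q.pbra A A ≤ A := pbra_le.mpr fun a ha b _ => (isIdeal_iff.mp hA.1 a ha b).2.2.1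
  refine (hA.2.2 _ (Q.isIdeal_pbra_self hA.1 hmul) hle).resolve_right fun heq => hA.2.1 ?_
  let := Q.lieRing
  let := Q.lieAlgebra
  let I : LieIdeal F P :=
    { A with lie_mem := fun {x a} ha => (isIdeal_iff.mp hA.1 a ha x).2.2.2 }
  have hperf : ⁅I, I⁆ = I := by
    refine le_antisymm (LieSubmodule.lie_le_right I I) ?_
    rw [← LieSubmodule.toSubmodule_le_toSubmodule]
    change A ≤ _
    conv_lhs => rw [← heq]
    exact pbra_le.mpr fun a ha b hb => LieSubmodule.lie_mem_lie (I := I) (N := I) ha hb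
  have hI := LieIdeal.eq_bot_of_lie_self_eq_of_isNilpotent_ad I hperf
    fun a ha => isNilpotent_bracket hA.1 hfrat ha
  exact congrArg LieSubmodule.toSubmodule hI

end PoissonAlgebra

/-- A finite-dimensional Poisson algebra is `φ`-free iff it splits over its zero socle. -/
theorem phi_free_iff_splits_over_zsoc {F P : Type*} [Field F] [AddCommGroup P] [Module F P]
    [FiniteDimensional F P] (Q : PoissonAlgebra F P) :
    Q.toDialgebra.phi = ⊥ ↔
      ∃ C, Q.toDialgebra.IsSubalgebra C ∧ Q.toDialgebra.zsoc ⊓ C = ⊥ ∧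
        Q.toDialgebra.zsoc ⊔ C = ⊤ := by
  constructor
  · intro h
    exact Dialgebra.isIdeal_zsoc.exists_isSubalgebra_isCompl Dialgebra.isZeroAlg_zsoc
      (by rw [h, inf_bot_eq])
  · rintro ⟨C, hC, hinf, hsup⟩
    refine sSup_eq_bot.mpr ?_
    rintro I ⟨hI, hfrat⟩
    by_contra hne
    obtain ⟨A, hA, hAI⟩ := hI.exists_isMinimalIdeal_le hne
    exact hA.not_le_frattini_of_splits
      (PoissonAlgebra.isZeroAlg_of_le_frattini hA (hAI.trans hfrat)) hC hinf hsup (hAI.trans hfrat)
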